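/- There exist constants c > 0 and x₀ ≥ 3 such that for all real x ≥ x₀, π(x) − x / log x ≥ c · x / (log x)². In particular, π(x) − x/log x is strictly positive for all sufficiently large x. -/

import Mathlib

open Finset Filter Real

/-- The prime counting function `π(x)`, the number of primes `p ≤ x`, as a real number. -/
noncomputable def primePi (x : ℝ) : ℝ :=
  (((Finset.Iic ⌊x⌋₊).filter Nat.Prime).card : ℝ)



namespace PNTaux

/-- the differences -/
noncomputable def Td (n : ℕ) (s : ℂ) : ℂ :=
  (s - 1) * ((n : ℂ) + 1) ^ (-s) + ((n : ℂ) + 2) ^ (1 - s) - ((n : ℂ) + 1) ^ (1 - s)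

lemma diff_bound1 (a x : ℝ) (ha : 1 ≤ a) (hx : x ∈ Set.Icc a (a + 1)) (s : ℂ) (hs : 0 < s.re) :
    ‖(a : ℂ) ^ (-s) - (x : ℂ) ^ (-s)‖ ≤ ‖s‖ * a ^ (-s.re - 1) := by
  have hs0 : s ≠ 0 := by rintro rfl; simp at hs
  have h := (convex_Icc a (a + 1)).norm_image_sub_le_of_norm_hasDerivWithin_le
    (f := fun x : ℝ => (x : ℂ) ^ (-s)) (f' := fun x : ℝ => (-s) * (x : ℂ) ^ (-s - 1))
    (C := ‖s‖ * a ^ (-s.re - 1)) (x := a) (y := x) ?_ ?_ (by simp) hx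
  · rw [norm_sub_rev]
    refine h.trans ?_
    have h0 : 0 ≤ ‖s‖ * a ^ (-s.re - 1) := by positivity
    have : ‖x - a‖ ≤ 1 := by
      rw [Real.norm_eq_abs, abs_le]; constructor <;> linarith [hx.1, hx.2]
    nlinarith
  · intro y hy
    have hy0 : 0 < y := by linarith [hy.1]
    have h2 := hasDerivAt_ofReal_cpow_const (x := y) (r := -s) hy0.ne' (neg_ne_zero.mpr hs0)
    exact h2.hasDerivWithinAt
  · intro y hy
    have hy0 : 0 < y := by linarith [hy.1]
    rw [norm_mul, norm_neg, Complex.norm_cpow_eq_rpow_re_of_pos hy0]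
    simp only [Complex.sub_re, Complex.neg_re, Complex.one_re]
    gcongr ‖s‖ * ?_
    exact Real.rpow_le_rpow_of_nonpos (by linarith) hy.1 (by linarith)

lemma diff_bound2 (a x : ℝ) (ha : 1 ≤ a) (hx : x ∈ Set.Icc a (a + 1)) (s : ℂ) (hs : 0 < s.re) :
    ‖(a : ℂ) ^ (-s) - (x : ℂ) ^ (-s)‖ ≤ 2 * a ^ (-s.re) := by
  have ha0 : 0 < a := by linarith
  have hy0 : 0 < x := by linarith [hx.1]
  refine (norm_sub_le _ _).trans ?_
  rw [Complex.norm_cpow_eq_rpow_re_of_pos hy0, Complex.norm_cpow_eq_rpow_re_of_pos ha0]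
  simp only [Complex.neg_re]
  have := Real.rpow_le_rpow_of_nonpos ha0 hx.1 (z := -s.re) (by linarith)
  linarith

lemma diff_bound (a x : ℝ) (ha : 1 ≤ a) (hx : x ∈ Set.Icc a (a + 1)) (s : ℂ) (hs : 99/100 ≤ s.re) :
    ‖(a : ℂ) ^ (-s) - (x : ℂ) ^ (-s)‖ ≤ 2 * ‖s‖ ^ (1/50 : ℝ) * a ^ (-(101/100) : ℝ) := by
  have h1 := diff_bound1 a x ha hx s (by linarith)
  have h2 := diff_bound2 a x ha hx s (by linarith)
  set A := ‖(a : ℂ) ^ (-s) - (x : ℂ) ^ (-s)‖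
  have hA : 0 ≤ A := norm_nonneg _
  have ha0 : 0 < a := by linarith
  calc A = A ^ (49/50 : ℝ) * A ^ (1/50 : ℝ) := by
        rw [← Real.rpow_add_of_nonneg hA (by norm_num) (by norm_num)]; norm_num
    _ ≤ (2 * a ^ (-s.re)) ^ (49/50 : ℝ) * (‖s‖ * a ^ (-s.re - 1)) ^ (1/50 : ℝ) := by gcongr
    _ = 2 ^ (49/50 : ℝ) * ‖s‖ ^ (1/50 : ℝ) * a ^ (-s.re - 1/50) := by
        rw [Real.mul_rpow (by norm_num) (by positivity), Real.mul_rpow (by positivity) (by positivity),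
          ← Real.rpow_mul ha0.le, ← Real.rpow_mul ha0.le]
        have : -s.re - 1/50 = -s.re * (49/50) + (-s.re - 1) * (1/50) := by ring
        rw [this, Real.rpow_add ha0]; ring
    _ ≤ 2 * ‖s‖ ^ (1/50 : ℝ) * a ^ (-(101/100) : ℝ) := by
        gcongr ?_ * _ * ?_
        · calc (2:ℝ) ^ (49/50 : ℝ) ≤ 2 ^ (1:ℝ) :=
              Real.rpow_le_rpow_of_exponent_le (by norm_num) (by norm_num)
            _ = 2 := by simp
        · exact Real.rpow_le_rpow_of_exponent_le ha (by linarith)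

lemma Td_bound (n : ℕ) (s : ℂ) (hs : 99/100 ≤ s.re) :
    ‖Td n s‖ ≤ ‖s - 1‖ * (2 * ‖s‖ ^ (1/50 : ℝ)) * ((n : ℝ) + 1) ^ (-(101/100) : ℝ) := by
  set a : ℝ := (n : ℝ) + 1 with ha_def
  have ha : 1 ≤ a := by simp [ha_def]
  have h := (convex_Icc a (a + 1)).norm_image_sub_le_of_norm_hasDerivWithin_le
    (f := fun x : ℝ => (s - 1) * (a : ℂ) ^ (-s) * x + (x : ℂ) ^ (1 - s))
    (f' := fun x : ℝ => (s - 1) * ((a : ℂ) ^ (-s) - (x : ℂ) ^ (-s)))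
    (C := ‖s - 1‖ * (2 * ‖s‖ ^ (1/50 : ℝ)) * a ^ (-(101/100) : ℝ)) (x := a) (y := a + 1) ?_ ?_
      (by simp) (by simp)
  · have e : Td n s = (s - 1) * (a : ℂ) ^ (-s) * (a + 1 : ℝ) + ((a + 1 : ℝ) : ℂ) ^ (1 - s)
      - ((s - 1) * (a : ℂ) ^ (-s) * a + (a : ℂ) ^ (1 - s)) := by
      have h1 : ((n : ℂ) + 1) = (a : ℂ) := by simp [ha_def]
      have h2 : ((n : ℂ) + 2) = ((a + 1 : ℝ) : ℂ) := by simp [ha_def]; ring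
      rw [Td, h1, h2]; push_cast; ring
    rw [e]
    refine h.trans ?_
    simp
  · intro y hy
    have hy0 : 0 < y := by linarith [hy.1]
    refine HasDerivAt.hasDerivWithinAt ?_
    by_cases h1 : s = 1
    · subst h1
      simp only [sub_self, zero_mul, Complex.cpow_zero, zero_add]
      exact hasDerivAt_const y (1 : ℂ)
    have hs1 : s - 1 ≠ 0 := sub_ne_zero.mpr h1
    have h2 := hasDerivAt_ofReal_cpow_const (x := y) (r := 1 - s) hy0.ne'
      (by intro h; apply hs1; linear_combination -h)
    have h3 : HasDerivAt (fun x : ℝ => (s - 1) * (a : ℂ) ^ (-s) * (x : ℂ)) ((s - 1) * (a : ℂ) ^ (-s) * 1) y :=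
      (HasDerivAt.ofReal_comp (hasDerivAt_id y)).const_mul _ 
    convert h3.fun_add h2 using 1
    have : 1 - s - 1 = -s := by ring
    rw [this]; ring
  · intro y hy
    rw [norm_mul, mul_assoc]
    gcongr
    exact diff_bound a y ha hy s hs

lemma Td_diff (n : ℕ) : Differentiable ℂ (Td n) := by
  have h1 : (n : ℂ) + 1 ≠ 0 := by exact_mod_cast Nat.succ_ne_zero n
  have h2 : (n : ℂ) + 2 ≠ 0 := by exact_mod_cast Nat.succ_ne_zero (n+1)
  unfold Td
  intro s
  refine DifferentiableAt.sub (DifferentiableAt.add (DifferentiableAt.mul (by fun_prop) ?_) ?_) ?_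
  · exact DifferentiableAt.const_cpow (by fun_prop) (Or.inl h1)
  · exact DifferentiableAt.const_cpow (by fun_prop) (Or.inl h2)
  · exact DifferentiableAt.const_cpow (by fun_prop) (Or.inl h1)

lemma summ_aux : Summable (fun n : ℕ => ((n : ℝ) + 1) ^ (-(101/100) : ℝ)) := by
  have := (Real.summable_nat_rpow (p := -(101/100))).mpr (by norm_num)
  have h := (summable_nat_add_iff 1).mpr this
  simpa using h

lemma Td_hasSum (s : ℂ) (hs : 1 < s.re) : HasSum (fun n => Td n s) ((s - 1) * riemannZeta s - 1) := by
  have hsum : Summable (fun n => Td n s) :=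
    Summable.of_norm_bounded (summ_aux.mul_left _) (fun n => Td_bound n s (by linarith))
  rw [hsum.hasSum_iff_tendsto_nat]
  have hz := zeta_eq_tsum_one_div_nat_add_one_cpow hs
  have hsz : Summable (fun n : ℕ => 1 / ((n : ℂ) + 1) ^ s) := by
    have := (summable_nat_add_iff 1).mpr (Complex.summable_one_div_nat_cpow.mpr hs)
    simpa using this
  have ht := hsz.hasSum.tendsto_sum_nat
  rw [← hz] at ht
  have hpart : ∀ N : ℕ, ∑ n ∈ range N, Td n s =
      (s - 1) * ∑ n ∈ range N, 1 / ((n : ℂ) + 1) ^ s + ((N : ℂ) + 1) ^ (1 - s) - 1 := by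
    intro N
    induction N with
    | zero => simp
    | succ N ih =>
      rw [sum_range_succ, ih, sum_range_succ, Td, Complex.cpow_neg]
      have : ((N + 1 : ℕ) : ℂ) + 1 = N + 2 := by push_cast; ring
      rw [this]; ring
  have hlim : Tendsto (fun N : ℕ => ((N : ℂ) + 1) ^ (1 - s)) atTop (nhds 0) := by
    rw [tendsto_zero_iff_norm_tendsto_zero]
    have : ∀ N : ℕ, ‖((N : ℂ) + 1) ^ (1 - s)‖ = ((N + 1 : ℕ) : ℝ) ^ (-(s.re - 1)) := by
      intro N
      have := Complex.norm_natCast_cpow_of_pos (n := N + 1) (by omega) (1 - s)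
      push_cast at this ⊢
      rw [this]; simp
    simp_rw [this]
    have h1 := tendsto_rpow_neg_atTop (y := s.re - 1) (by linarith)
    exact h1.comp (tendsto_natCast_atTop_atTop.comp (tendsto_add_atTop_nat 1))
  simp_rw [hpart]
  have := ((ht.const_mul (s - 1)).add hlim).sub_const 1
  simpa using this

end PNTaux


namespace PNTaux

/-- the entire function (s-1) zeta(s) -/
noncomputable def Z : ℂ → ℂ := Function.update (fun s => (s - 1) * riemannZeta s) 1 1

lemma Z_one : Z 1 = 1 := by simp [Z]

lemma Z_ne {s : ℂ} (hs : s ≠ 1) : Z s = (s - 1) * riemannZeta s := by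
  simp [Z, Function.update_of_ne hs]

lemma Z_diff : Differentiable ℂ Z := by
  rw [← differentiableOn_univ,
    ← Complex.differentiableOn_compl_singleton_and_continuousAt_iff (c := 1) Filter.univ_mem]
  refine ⟨DifferentiableOn.congr (f := fun s ↦ (s - 1) * riemannZeta s)
    (fun s hs ↦ DifferentiableAt.differentiableWithinAt <|
      (by fun_prop : DifferentiableAt ℂ (fun s : ℂ => s - 1) s).mul (differentiableAt_riemannZeta hs.2))
    (fun s hs ↦ Z_ne hs.2), ?_⟩
  exact continuousAt_update_same.mpr riemannZeta_residue_one

lemma Z_hasSum (s : ℂ) (hs : 99/100 < s.re) : HasSum (fun n => Td n s) (Z s - 1) := by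
  have hsum : Summable (fun n => Td n s) :=
    Summable.of_norm_bounded (summ_aux.mul_left _) (fun n => Td_bound n s (by linarith))
  set R : ℝ := ‖s‖ + 3
  set U : Set ℂ := Metric.ball 0 R ∩ {z | 99/100 < z.re} with hU
  have hUo : IsOpen U := Metric.isOpen_ball.inter (isOpen_lt continuous_const Complex.continuous_re)
  have hUc : Convex ℝ U := (convex_ball _ _).inter (convex_halfSpace_re_gt _)
  have hd : DifferentiableOn ℂ (fun z => ∑' n, Td n z) U := by
    refine Complex.differentiableOn_tsum_of_summable_norm
      (u := fun n : ℕ => (R + 1) * (2 * R ^ (1/50 : ℝ)) * ((n : ℝ) + 1) ^ (-(101/100) : ℝ))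
      (summ_aux.mul_left _) (fun n => (Td_diff n).differentiableOn) hUo ?_
    intro n z hz
    refine (Td_bound n z (le_of_lt hz.2)).trans ?_
    have h1 : ‖z‖ ≤ R := (mem_ball_zero_iff.mp hz.1).le
    have h2 : ‖z - 1‖ ≤ R + 1 := (norm_sub_le _ _).trans (by simpa using h1)
    have : 0 ≤ R := by positivity
    gcongr
  have key : Set.EqOn (fun z => ∑' n, Td n z) (fun z => Z z - 1) U := by
    refine (hd.analyticOnNhd hUo).eqOn_of_preconnected_of_eventuallyEq
      ((Z_diff.sub_const 1).differentiableOn.analyticOnNhd hUo) hUc.isPreconnected (z₀ := 2) ?_ ?_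
    · refine ⟨?_, by simp; norm_num⟩
      simp [R]; linarith [norm_nonneg s]
    · have : {z : ℂ | 1 < z.re} ∈ nhds (2 : ℂ) :=
        (isOpen_lt continuous_const Complex.continuous_re).mem_nhds (by simp)
      filter_upwards [this] with z hz
      have hz1 : z ≠ 1 := by rintro rfl; simp at hz
      rw [(Td_hasSum z hz).tsum_eq, Z_ne hz1]
  have hsU : s ∈ U := ⟨by simp [R], hs⟩
  have := key hsU
  simp only at this
  rw [← this]
  exact hsum.hasSum

/-- growth gauge -/
noncomputable def T (t : ℝ) : ℝ := (|t| + 3) ^ (1/50 : ℝ)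

lemma T_ge (t : ℝ) : 1 ≤ T t := Real.one_le_rpow (by linarith [abs_nonneg t]) (by norm_num)

lemma T_pos (t : ℝ) : 0 < T t := lt_of_lt_of_le one_pos (T_ge t)

lemma T_two {x t : ℝ} (hx : 0 ≤ x) (h : x ≤ 2 * (|t| + 3)) : x ^ (1/50 : ℝ) ≤ 2 * T t := by
  have h0 := abs_nonneg t
  calc x ^ (1/50 : ℝ) ≤ (2 * (|t| + 3)) ^ (1/50 : ℝ) := by gcongr
    _ = 2 ^ (1/50 : ℝ) * T t := by rw [Real.mul_rpow (by norm_num) (by positivity), T]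
    _ ≤ 2 * T t := by
      have : (2:ℝ) ^ (1/50 : ℝ) ≤ 2 ^ (1:ℝ) :=
        Real.rpow_le_rpow_of_exponent_le (by norm_num) (by norm_num)
      rw [Real.rpow_one] at this
      exact mul_le_mul_of_nonneg_right this (T_pos t).le

lemma T_near {t t' : ℝ} (h : |t'| ≤ 2 * |t| + 3) : T t' ≤ 2 * T t :=
  T_two (by positivity) (by linarith)

lemma zeta_pole_bound : ∃ C : ℝ, 1 ≤ C ∧ ∀ s : ℂ, 99/100 < s.re → s ≠ 1 →
    ‖riemannZeta s‖ ≤ 1 / ‖s - 1‖ + C * ‖s‖ ^ (1/50 : ℝ) := by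
  refine ⟨1 + 2 * ∑' n : ℕ, ((n : ℝ) + 1) ^ (-(101/100) : ℝ), ?_, ?_⟩
  · have : 0 ≤ ∑' n : ℕ, ((n : ℝ) + 1) ^ (-(101/100) : ℝ) := tsum_nonneg (fun n => by positivity)
    linarith
  intro s hs h1
  have hz := Z_hasSum s hs
  have hb : ‖Z s - 1‖ ≤ ‖s - 1‖ * (2 * ‖s‖ ^ (1/50 : ℝ)) * ∑' n : ℕ, ((n : ℝ) + 1) ^ (-(101/100) : ℝ) := by
    rw [← hz.tsum_eq, ← tsum_mul_left]
    exact tsum_of_norm_bounded (summ_aux.mul_left _).hasSum (fun n => Td_bound n s hs.le)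
  have hp : 0 < ‖s - 1‖ := norm_pos_iff.mpr (sub_ne_zero.mpr h1)
  have hZ : ‖Z s‖ ≤ 1 + ‖Z s - 1‖ := by
    have := norm_add_le (1:ℂ) (Z s - 1)
    simpa using this
  rw [Z_ne h1, norm_mul] at hZ
  rw [Z_ne h1] at hb
  set S := ∑' n : ℕ, ((n : ℝ) + 1) ^ (-(101/100) : ℝ)
  have : ‖riemannZeta s‖ ≤ (1 + ‖s - 1‖ * (2 * ‖s‖ ^ (1/50 : ℝ)) * S) / ‖s - 1‖ := by
    rw [le_div_iff₀ hp]; linarith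
  refine this.trans ?_
  rw [add_div]
  have e : ‖s - 1‖ * (2 * ‖s‖ ^ (1/50 : ℝ)) * S / ‖s - 1‖ = 2 * ‖s‖ ^ (1/50 : ℝ) * S := by
    field_simp
  rw [e]
  have : 0 ≤ ‖s‖ ^ (1/50 : ℝ) := by positivity
  nlinarith

lemma im_le_norm_sub_one (s : ℂ) : |s.im| ≤ ‖s - 1‖ := by
  have := Complex.abs_im_le_norm (s - 1)
  simpa using this

lemma zeta_bound : ∃ C : ℝ, 1 ≤ C ∧ ∀ s : ℂ, 99/100 < s.re → s.re ≤ 4 → 1/2 ≤ |s.im| →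
    ‖riemannZeta s‖ ≤ C * T s.im := by
  obtain ⟨C, hC, h⟩ := zeta_pole_bound
  refine ⟨2 + 2 * C, by linarith, fun s h1 h2 h3 => ?_⟩
  have hn := im_le_norm_sub_one s
  have hne : s ≠ 1 := by rintro rfl; norm_num at h3
  refine (h s h1 hne).trans ?_
  have e1 : 1 / ‖s - 1‖ ≤ 2 := by
    rw [div_le_iff₀ (by linarith)]; linarith
  have e2 : ‖s‖ ^ (1/50 : ℝ) ≤ 2 * T s.im := by
    apply T_two (norm_nonneg _)
    have := Complex.norm_le_abs_re_add_abs_im s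
    rw [abs_of_pos (by linarith : 0 < s.re)] at this
    linarith
  have := T_ge s.im
  nlinarith

lemma zeta_deriv_bound : ∃ C : ℝ, 1 ≤ C ∧ ∀ s : ℂ, 199/200 ≤ s.re → s.re ≤ 3 → 1 ≤ |s.im| →
    ‖deriv riemannZeta s‖ ≤ C * T s.im := by
  obtain ⟨C, hC, h⟩ := zeta_bound
  refine ⟨C * 2 * 400, by linarith, fun s h1 h2 h3 => ?_⟩
  have hsph : ∀ z ∈ Metric.closedBall s (1/400), |z.re - s.re| ≤ 1/400 ∧ |z.im - s.im| ≤ 1/400 := by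
    intro z hz
    rw [Metric.mem_closedBall, dist_eq_norm] at hz
    have a1 := Complex.abs_re_le_norm (z - s)
    have a2 := Complex.abs_im_le_norm (z - s)
    rw [Complex.sub_re] at a1
    rw [Complex.sub_im] at a2
    exact ⟨a1.trans hz, a2.trans hz⟩
  have him : ∀ z ∈ Metric.closedBall s (1/400), 1/2 ≤ |z.im| ∧ |z.im| ≤ |s.im| + 1 := by
    intro z hz
    have h4 := (hsph z hz).2
    have h5 := abs_sub_abs_le_abs_sub s.im z.im
    have h6 := abs_sub_abs_le_abs_sub z.im s.im
    rw [abs_sub_comm] at h5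
    constructor <;> linarith
  have := Complex.norm_deriv_le_of_forall_mem_sphere_norm_le (c := s) (R := 1/400)
    (C := C * (2 * T s.im)) (f := riemannZeta) (by norm_num) ?_ ?_
  · refine this.trans (le_of_eq ?_)
    ring
  · apply DifferentiableOn.diffContOnCl_ball (U := Metric.closedBall s (1/400)) _ le_rfl
    intro z hz
    apply DifferentiableAt.differentiableWithinAt
    apply differentiableAt_riemannZeta
    rintro rfl
    have := (him 1 hz).1
    norm_num at this
  · intro z hz
    have hz' := Metric.sphere_subset_closedBall hz
    have h4 := abs_le.mp (hsph z hz').1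
    obtain ⟨h5, h6⟩ := him z hz'
    refine (h z (by linarith [h4.1]) (by linarith [h4.2]) h5).trans ?_
    gcongr
    exact T_near (by linarith [abs_nonneg s.im])

end PNTaux


namespace PNTaux

lemma zeta_341 {x : ℝ} (hx : 0 < x) (y : ℝ) :
    1 ≤ ‖riemannZeta (1 + x)‖ ^ 3 * ‖riemannZeta (1 + x + Complex.I * y)‖ ^ 4 *
      ‖riemannZeta (1 + x + 2 * Complex.I * y)‖ := by
  have h := DirichletCharacter.norm_LSeries_product_ge_one (N := 1) 1 hx y
  have e1 : (fun n : ℕ => ((1 : DirichletCharacter ℂ 1) n)) = 1 := by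
    ext n
    rw [Pi.one_apply]; exact MulChar.one_apply (isUnit_of_subsingleton _)
  rw [one_pow, e1, LSeries_one_eq_riemannZeta (by simpa using hx),
    LSeries_one_eq_riemannZeta (by simpa using hx), LSeries_one_eq_riemannZeta (by simpa using hx)] at h
  simpa [norm_mul, norm_pow] using h

lemma zeta_lower_right : ∃ c : ℝ, 0 < c ∧ ∀ x t : ℝ, 0 < x → x ≤ 2 → 1 ≤ |t| →
    c * x ^ 3 / T t ≤ ‖riemannZeta (1 + x + Complex.I * t)‖ ^ 4 := by
  obtain ⟨C, hC, h⟩ := zeta_bound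
  obtain ⟨D, hD, h'⟩ := zeta_pole_bound
  set E : ℝ := 1 + D * 8 with hE
  have hEpos : 0 < E := by positivity
  refine ⟨1 / (E ^ 3 * (C * 2)), by positivity, fun x t hx hx2 ht => ?_⟩
  have h3 := zeta_341 hx t
  have b1 : ‖riemannZeta (1 + x)‖ ≤ E / x := by
    have hn : ‖(1 + x : ℂ)‖ = 1 + x := by
      have : (1 + x : ℂ) = ((1 + x : ℝ) : ℂ) := by push_cast; rfl
      rw [this, Complex.norm_real, Real.norm_of_nonneg (by linarith)]
    have := h' (1 + x) (by simp; linarith) (by simp; exact_mod_cast hx.ne')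
    rw [hn] at this
    refine this.trans ?_
    have e : ‖(1 + x - 1 : ℂ)‖ = x := by simp [abs_of_pos hx]
    rw [e]
    have e2 : (1 + x) ^ (1/50 : ℝ) ≤ 4 := by
      calc (1 + x) ^ (1/50 : ℝ) ≤ (1 + x) ^ (1 : ℝ) :=
            Real.rpow_le_rpow_of_exponent_le (by linarith) (by norm_num)
        _ ≤ 4 := by rw [Real.rpow_one]; linarith
    rw [hE, add_div]
    have : D * (1 + x) ^ (1/50 : ℝ) ≤ D * 8 / x := by
      rw [le_div_iff₀ hx]
      have : (1 + x) ^ (1/50 : ℝ) * x ≤ 4 * 2 := by gcongr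
      nlinarith
    linarith
  have b2 : ‖riemannZeta (1 + x + 2 * Complex.I * t)‖ ≤ C * (2 * T t) := by
    have e := h (1 + x + 2 * Complex.I * t) (by simp; linarith) (by simp; linarith)
      (by simp; linarith)
    refine e.trans ?_
    gcongr
    apply T_near
    simp
  set W := ‖riemannZeta (1 + x + Complex.I * t)‖ ^ 4 with hW
  have hW0 : 0 ≤ W := by positivity
  have hT := T_pos t
  have : 1 ≤ (E / x) ^ 3 * W * (C * (2 * T t)) := by
    refine h3.trans ?_
    gcongr
  have e : (E / x) ^ 3 * W * (C * (2 * T t)) = W * (E ^ 3 * (C * 2) * T t / x ^ 3) := by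
    field_simp
  rw [e] at this
  have hq : 0 < E ^ 3 * (C * 2) * T t / x ^ 3 := by positivity
  have h5 : 1 / (E ^ 3 * (C * 2)) * x ^ 3 / T t = 1 / (E ^ 3 * (C * 2) * T t / x ^ 3) := by
    field_simp
  rw [h5, div_le_iff₀ hq]
  exact this

lemma zeta_lower : ∃ b m : ℝ, 0 < b ∧ b ≤ 1/200 ∧ 0 < m ∧ ∀ s : ℂ, 1 - b / T s.im ^ 5 ≤ s.re →
    s.re ≤ 3 → 1 ≤ |s.im| → m / T s.im ^ 4 ≤ ‖riemannZeta s‖ := by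
  obtain ⟨c, hc, hlow⟩ := zeta_lower_right
  obtain ⟨C, hC, hder⟩ := zeta_deriv_bound
  -- c1 ^ 4 = c
  set c1 : ℝ := c ^ (1/4 : ℝ) with hc1
  have hc1p : 0 < c1 := by positivity
  have hc14 : c1 ^ 4 = c := by
    rw [hc1, ← Real.rpow_natCast, ← Real.rpow_mul hc.le]; norm_num
  set β : ℝ := min (1/4) (c1 / (4 * C)) with hβ
  have hβp : 0 < β := by rw [hβ]; positivity
  have hβ1 : β ≤ 1/4 := min_le_left _ _
  have hβ2 : β * (4 * C) ≤ c1 := by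
    rw [← le_div_iff₀ (by positivity)]; exact min_le_right _ _
  have hb : β ^ 4 ≤ 1/200 := by
    calc β ^ 4 ≤ (1/4) ^ 4 := by gcongr
      _ ≤ 1/200 := by norm_num
  refine ⟨β ^ 4, c1 * β ^ 3 / 2, by positivity, hb, by positivity, ?_⟩
  intro s h1 h3 ht
  set t := s.im with htdef
  set τ := T t with hτ
  have hτ1 : 1 ≤ τ := T_ge t
  have hτp : 0 < τ := T_pos t
  set η := β ^ 4 / τ ^ 5 with hη
  have hηp : 0 < η := by positivity
  have hη1 : η ≤ 1/200 := by
    rw [hη, div_le_iff₀ (by positivity)]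
    have : 1 ≤ τ ^ 5 := one_le_pow₀ hτ1
    linarith
  -- lower bound to the right
  have hright : ∀ x : ℝ, η ≤ x → x ≤ 2 → c1 * β ^ 3 / τ ^ 4 ≤ ‖riemannZeta (1 + x + Complex.I * t)‖ := by
    intro x hx hx2
    have := hlow x t (by linarith) hx2 ht
    apply le_of_pow_le_pow_left₀ (n := 4) (by norm_num) (norm_nonneg _)
    refine le_trans ?_ this
    calc (c1 * β ^ 3 / τ ^ 4) ^ 4 = c * η ^ 3 / τ := by
          rw [hη, ← hc14]; field_simp
      _ ≤ c * x ^ 3 / τ := by gcongr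
  by_cases hcase : 1 + η ≤ s.re
  · have := hright (s.re - 1) (by linarith) (by linarith)
    have es : (1 : ℂ) + ((s.re - 1 : ℝ) : ℂ) + Complex.I * t = s := by
      apply Complex.ext <;> simp [htdef]
    rw [es] at this
    refine le_trans ?_ this
    gcongr
    have : 0 < c1 * β ^ 3 := by positivity
    linarith
  · push Not at hcase
    have h0 := hright η le_rfl (by linarith)
    -- mean value
    have hmv := (convex_Icc (1 - η) (1 + η)).norm_image_sub_le_of_norm_hasDerivWithin_le
      (f := fun u : ℝ => riemannZeta (u + Complex.I * t))
      (f' := fun u : ℝ => deriv riemannZeta (u + Complex.I * t))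
      (C := C * τ) (x := s.re) (y := 1 + η) ?_ ?_ ⟨h1, hcase.le⟩ ⟨by linarith, le_rfl⟩
    · have es : (s.re : ℂ) + Complex.I * t = s := by
        apply Complex.ext <;> simp [htdef]
      rw [es] at hmv
      have hw : ‖(1 + η) - s.re‖ ≤ 2 * η := by
        rw [Real.norm_eq_abs, abs_le]; constructor <;> linarith
      have h4 : ‖riemannZeta (((1 + η : ℝ) : ℂ) + Complex.I * t) - riemannZeta s‖ ≤ C * τ * (2 * η) := by
        refine hmv.trans ?_
        gcongr
      have h5 : c1 * β ^ 3 / τ ^ 4 ≤ ‖riemannZeta (((1 + η : ℝ) : ℂ) + Complex.I * t)‖ := by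
        push_cast; exact h0
      have h6 : C * τ * (2 * η) ≤ c1 * β ^ 3 / 2 / τ ^ 4 := by
        have : C * τ * (2 * η) = (β * (4 * C)) * β ^ 3 / 2 / τ ^ 4 := by
          rw [hη]; field_simp; ring
        rw [this]
        gcongr
      have h7 := norm_sub_norm_le (riemannZeta (((1 + η : ℝ) : ℂ) + Complex.I * t)) (riemannZeta s)
      have h8 : c1 * β ^ 3 / τ ^ 4 = 2 * (c1 * β ^ 3 / 2 / τ ^ 4) := by ring
      linarith
    · intro u hu
      have hne : (u : ℂ) + Complex.I * t ≠ 1 := by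
        intro h
        have := congrArg Complex.im h
        simp at this
        rw [this] at ht; norm_num at ht
      have hd := (differentiableAt_riemannZeta hne).hasDerivAt
      have h2 : HasDerivAt (fun u : ℂ => u + Complex.I * t) 1 (u : ℂ) :=
        (hasDerivAt_id (u : ℂ)).add_const _
      have h3 := HasDerivAt.comp (u : ℂ) (h₂ := riemannZeta) hd h2
      rw [mul_one] at h3
      exact h3.comp_ofReal.hasDerivWithinAt
    · intro u hu
      have := hder (u + Complex.I * t) (by simp; linarith [hu.1]) (by simp; linarith [hu.2])
        (by simpa using ht)
      simpa using this

end PNTaux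


namespace PNTaux

/-- `-ζ'/ζ - ζ`, regularised at `1` -/
noncomputable def G (s : ℂ) : ℂ := - deriv Z s / Z s - dslope Z 1 s

lemma Z_open : IsOpen {s | Z s ≠ 0} := isOpen_ne_fun Z_diff.continuous continuous_const

lemma G_diffOn : DifferentiableOn ℂ G {s | Z s ≠ 0} := by
  have h1 : DifferentiableOn ℂ (dslope Z 1) Set.univ :=
    (Complex.differentiableOn_dslope Filter.univ_mem).mpr Z_diff.differentiableOn
  have h2 : Differentiable ℂ (deriv Z) := by
    have := Z_diff.differentiableOn (s := Set.univ) |>.deriv isOpen_univ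
    exact differentiableOn_univ.mp this
  unfold G
  refine DifferentiableOn.sub (DifferentiableOn.div h2.neg.differentiableOn Z_diff.differentiableOn
    (fun s hs => hs)) (h1.mono (Set.subset_univ _))

lemma Z_ne_zero {s : ℂ} (hs : 1 ≤ s.re) : Z s ≠ 0 := by
  by_cases h : s = 1
  · rw [h, Z_one]; exact one_ne_zero
  · rw [Z_ne h]
    exact mul_ne_zero (sub_ne_zero.mpr h) (riemannZeta_ne_zero_of_one_le_re hs)

lemma G_eq {s : ℂ} (hs : s ≠ 1) (hz : riemannZeta s ≠ 0) :
    G s = - deriv riemannZeta s / riemannZeta s - riemannZeta s := by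
  have hs1 : s - 1 ≠ 0 := sub_ne_zero.mpr hs
  have hd : deriv Z s = riemannZeta s + (s - 1) * deriv riemannZeta s := by
    have he : Z =ᶠ[nhds s] fun s => (s - 1) * riemannZeta s := by
      filter_upwards [isOpen_ne.mem_nhds hs] with z hz using Z_ne hz
    rw [he.deriv_eq]
    have h1 : HasDerivAt (fun s : ℂ => s - 1) 1 s := (hasDerivAt_id s).sub_const 1
    have := h1.fun_mul (differentiableAt_riemannZeta hs).hasDerivAt
    rw [this.deriv]; ring
  rw [G, hd, dslope_of_ne _ hs, slope_def_field, Z_ne hs, Z_one]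
  field_simp
  ring

lemma G_bound_high : ∃ C : ℝ, 0 ≤ C ∧ ∀ k ≤ 4, ∀ s : ℂ, 1 < s.re → s.re ≤ 2 → 2 ≤ |s.im| →
    ‖iteratedDeriv k G s‖ ≤ C * T s.im ^ 25 := by
  obtain ⟨b, m, hb, hb2, hm, hlow⟩ := zeta_lower
  obtain ⟨C, hC, hz⟩ := zeta_bound
  obtain ⟨D, hD, hd⟩ := zeta_deriv_bound
  set M : ℝ := D * 2 * 16 / m + C with hM
  have hM0 : 0 < M := by positivity
  set q : ℝ := b / 32 with hq
  have hq0 : 0 < q := by positivity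
  have hq1 : q ≤ 1 := by rw [hq]; linarith
  refine ⟨24 * (M * 32) / q ^ 4, by positivity, fun k hk s h1 h2 ht => ?_⟩
  set τ := T s.im with hτ
  have hτ1 : 1 ≤ τ := T_ge _
  have hτp : 0 < τ := T_pos _
  set r := q / τ ^ 5 with hr
  have hrp : 0 < r := by positivity
  have hr1 : r ≤ 1/200 := by
    rw [hr, div_le_iff₀ (by positivity)]
    have : 1 ≤ τ ^ 5 := one_le_pow₀ hτ1
    rw [hq]; linarith
  have hsph : ∀ z ∈ Metric.closedBall s r, |z.re - s.re| ≤ r ∧ |z.im - s.im| ≤ r := by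
    intro z hz
    rw [Metric.mem_closedBall, dist_eq_norm] at hz
    have a1 := Complex.abs_re_le_norm (z - s)
    have a2 := Complex.abs_im_le_norm (z - s)
    rw [Complex.sub_re] at a1
    rw [Complex.sub_im] at a2
    exact ⟨a1.trans hz, a2.trans hz⟩
  have him : ∀ z ∈ Metric.closedBall s r, 1 ≤ |z.im| ∧ T z.im ≤ 2 * τ := by
    intro z hz
    have h4 := (hsph z hz).2
    have h5 := abs_sub_abs_le_abs_sub s.im z.im
    have h6 := abs_sub_abs_le_abs_sub z.im s.im
    rw [abs_sub_comm] at h5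
    constructor
    · linarith
    · exact T_near (by linarith [abs_nonneg s.im])
  have hreg : ∀ z ∈ Metric.closedBall s r, 1 - b / T z.im ^ 5 ≤ z.re ∧ z.re ≤ 3 := by
    intro z hz
    have h4 := abs_le.mp (hsph z hz).1
    have h5 := (him z hz).2
    have hTp := T_pos z.im
    constructor
    · have : r ≤ b / T z.im ^ 5 := by
        calc r = b / (2 * τ) ^ 5 := by rw [hr, hq]; field_simp; norm_num
          _ ≤ b / T z.im ^ 5 := by gcongr
      linarith [h4.1]
    · linarith [h4.2]
  have hzl : ∀ z ∈ Metric.closedBall s r, m / T z.im ^ 4 ≤ ‖riemannZeta z‖ := fun z hz =>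
    hlow z (hreg z hz).1 (hreg z hz).2 (him z hz).1
  have hz1 : ∀ z ∈ Metric.closedBall s r, z ≠ 1 := by
    rintro z hz rfl
    have := (him 1 hz).1
    norm_num at this
  have hz0 : ∀ z ∈ Metric.closedBall s r, riemannZeta z ≠ 0 := by
    intro z hz h0
    have := hzl z hz
    rw [h0, norm_zero] at this
    have hTp := T_pos z.im
    have : 0 < m / T z.im ^ 4 := by positivity
    linarith
  have hbd : ∀ z ∈ Metric.closedBall s r, ‖G z‖ ≤ M * 32 * τ ^ 5 := by
    intro z hz'
    have hTp := T_pos z.im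
    have hT1 := T_ge z.im
    have hT2 := (him z hz').2
    have hre := abs_le.mp (hsph z hz').1
    rw [G_eq (hz1 z hz') (hz0 z hz')]
    have n1 : ‖riemannZeta z‖ ≤ C * T z.im :=
      hz z (by linarith) (by linarith [(hreg z hz').2]) (by linarith [(him z hz').1])
    have n2 : ‖deriv riemannZeta z‖ ≤ D * T z.im :=
      hd z (by linarith) (hreg z hz').2 (him z hz').1
    have n3 := hzl z hz'
    have n4 : ‖- deriv riemannZeta z / riemannZeta z‖ ≤ D * T z.im / (m / T z.im ^ 4) := by
      rw [norm_div, norm_neg]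
      gcongr
    have n5 : D * T z.im / (m / T z.im ^ 4) = D / m * T z.im ^ 5 := by field_simp
    have n6 : C * T z.im ≤ C * T z.im ^ 5 := by
      gcongr
      exact le_self_pow₀ hT1 (by norm_num)
    have n7 : T z.im ^ 5 ≤ 32 * τ ^ 5 := by
      calc T z.im ^ 5 ≤ (2 * τ) ^ 5 := by gcongr
        _ = 32 * τ ^ 5 := by ring
    have n8 : D / m + C ≤ M := by
      rw [hM]
      have : D / m ≤ D * 2 * 16 / m := by gcongr; linarith
      linarith
    calc _ ≤ _ := norm_sub_le _ _
      _ ≤ D / m * T z.im ^ 5 + C * T z.im ^ 5 := by rw [← n5]; linarith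
      _ = (D / m + C) * T z.im ^ 5 := by ring
      _ ≤ M * (32 * τ ^ 5) := by gcongr
      _ = _ := by ring
  have hdc : DiffContOnCl ℂ G (Metric.ball s r) := by
    apply DifferentiableOn.diffContOnCl_ball (U := Metric.closedBall s r) _ le_rfl
    refine G_diffOn.mono (fun z hz => ?_)
    show Z z ≠ 0
    rw [Z_ne (hz1 z hz)]
    exact mul_ne_zero (sub_ne_zero.mpr (hz1 z hz)) (hz0 z hz)
  have := Complex.norm_iteratedDeriv_le_of_forall_mem_sphere_norm_le k hrp hdc
    (fun z hz => hbd z (Metric.sphere_subset_closedBall hz))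
  refine this.trans ?_
  have hf : (k.factorial : ℝ) ≤ 24 := by
    have : k.factorial ≤ Nat.factorial 4 := Nat.factorial_le hk
    exact_mod_cast this
  have hrk : q ^ 4 / τ ^ 20 ≤ r ^ k := by
    calc q ^ 4 / τ ^ 20 = r ^ 4 := by rw [hr]; field_simp
      _ ≤ r ^ k := pow_le_pow_of_le_one hrp.le (by linarith) hk
  calc _ ≤ 24 * (M * 32 * τ ^ 5) / (q ^ 4 / τ ^ 20) := by gcongr
    _ = _ := by field_simp

lemma G_bound (k : ℕ) (hk : k ≤ 4) : ∃ C : ℝ, 0 ≤ C ∧ ∀ s : ℂ, 1 < s.re → s.re ≤ 2 →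
    ‖iteratedDeriv k G s‖ ≤ C * (|s.im| + 3) ^ (1/2 : ℝ) := by
  obtain ⟨C, hC, h⟩ := G_bound_high
  have hcont : ContinuousOn (iteratedDeriv k G) {s | Z s ≠ 0} := by
    have ha : AnalyticOnNhd ℂ G {s | Z s ≠ 0} := G_diffOn.analyticOnNhd Z_open
    exact (ha.iterated_deriv k |>.continuousOn).congr (fun s _ => by rw [iteratedDeriv_eq_iterate])
  have hK : IsCompact (Set.Icc (1:ℝ) 2 ×ℂ Set.Icc (-2:ℝ) 2) := isCompact_Icc.reProdIm isCompact_Icc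
  obtain ⟨D, hD⟩ := hK.exists_bound_of_continuousOn (hcont.mono (fun s hs => Z_ne_zero hs.1.1))
  refine ⟨C + max D 0, by positivity, fun s h1 h2 => ?_⟩
  have hT : T s.im ^ 25 = (|s.im| + 3) ^ (1/2 : ℝ) := by
    have : 0 ≤ |s.im| + 3 := by positivity
    rw [T, ← Real.rpow_natCast, ← Real.rpow_mul this]; norm_num
  have h1T : 1 ≤ (|s.im| + 3) ^ (1/2 : ℝ) :=
    Real.one_le_rpow (by linarith [abs_nonneg s.im]) (by norm_num)
  have hm : 0 ≤ max D 0 := le_max_right _ _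
  by_cases ht : 2 ≤ |s.im|
  · have := h k hk s h1 h2 ht
    rw [hT] at this
    nlinarith
  · push Not at ht
    have h3 := abs_lt.mp ht
    have := hD s ⟨⟨h1.le, h2⟩, ⟨h3.1.le, h3.2.le⟩⟩
    have h4 := le_max_left D 0
    nlinarith

/-- coefficients -/
noncomputable def co (k : ℕ) (n : ℕ) : ℝ := (ArithmeticFunction.vonMangoldt n - 1) * Real.log n ^ k

lemma logMul_iter (f : ℕ → ℂ) (k n : ℕ) :
    (LSeries.logMul^[k] f) n = f n * (Real.log n : ℂ) ^ k := by
  induction k with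
  | zero => simp
  | succ k ih =>
    rw [Function.iterate_succ_apply', LSeries.logMul, ih, pow_succ, ← Complex.natCast_log]; ring

lemma G_LSeries (k : ℕ) (s : ℂ) (hs : 1 < s.re) :
    LSeriesSummable (fun n => (co k n : ℂ)) s ∧
    LSeries (fun n => (co k n : ℂ)) s = (-1) ^ k * iteratedDeriv k G s := by
  set f : ℕ → ℂ := fun n => ((ArithmeticFunction.vonMangoldt n : ℝ) : ℂ) - 1 with hf
  have hsum : ∀ z : ℂ, 1 < z.re → LSeriesSummable f z := by
    intro z hz
    exact (ArithmeticFunction.LSeriesSummable_vonMangoldt hz).sub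
      ((LSeriesSummable_one_iff).mpr hz)
  have habs : LSeries.abscissaOfAbsConv f ≤ 1 := by
    apply LSeries.abscissaOfAbsConv_le_of_forall_lt_LSeriesSummable
    intro y hy
    exact hsum y (by simpa using hy)
  have habs' : LSeries.abscissaOfAbsConv f < s.re :=
    lt_of_le_of_lt habs (by exact_mod_cast hs)
  have hco : (fun n => (co k n : ℂ)) = LSeries.logMul^[k] f := by
    ext n
    rw [logMul_iter, co, hf]
    push_cast
    rfl
  have heq : ∀ z : ℂ, 1 < z.re → LSeries f z = G z := by
    intro z hz
    have hz1 : z ≠ 1 := by rintro rfl; simp at hz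
    rw [G_eq hz1 (riemannZeta_ne_zero_of_one_le_re hz.le),
      ← ArithmeticFunction.LSeries_vonMangoldt_eq_deriv_riemannZeta_div hz,
      ← LSeries_one_eq_riemannZeta hz,
      ← LSeries_sub (ArithmeticFunction.LSeriesSummable_vonMangoldt hz)
      ((LSeriesSummable_one_iff).mpr hz)]
    rfl
  have hev : LSeries f =ᶠ[nhds s] G := by
    filter_upwards [(isOpen_lt continuous_const Complex.continuous_re).mem_nhds hs] with z hz
    exact heq z hz
  constructor
  · rw [hco]
    apply LSeriesSummable_of_abscissaOfAbsConv_lt_re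
    rw [LSeries.absicssaOfAbsConv_logPowMul]
    exact habs'
  · rw [hco]
    have h1 := LSeries_iteratedDeriv k habs'
    rw [hev.iteratedDeriv_eq k] at h1
    rw [h1, ← mul_assoc, ← mul_pow]
    simp

end PNTaux


namespace PNTaux

/-- Cesaro kernel -/
noncomputable def K (s : ℂ) : ℂ := 1 / s - 1 / (s + 1)

lemma K_bound (σ t : ℝ) (hσ : 1 ≤ σ) :
    ‖K (σ + t * Complex.I)‖ ≤ 4 * (1 + ‖t‖) ^ (-2 : ℝ) := by
  set s : ℂ := σ + t * Complex.I with hs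
  have hre : s.re = σ := by simp [hs]
  have him : s.im = t := by simp [hs]
  have h0 : s ≠ 0 := by intro h; rw [h] at hre; simp at hre; linarith
  have h1 : s + 1 ≠ 0 := by
    intro h
    have := congrArg Complex.re h
    simp [hre] at this; linarith
  have hK : K s = 1 / (s * (s + 1)) := by
    rw [K]; field_simp; ring
  have hn : (1 + ‖t‖) / 2 ≤ ‖s‖ := by
    have a := Complex.abs_re_le_norm s
    have b := Complex.abs_im_le_norm s
    rw [hre, abs_of_pos (by linarith)] at a
    rw [him] at b
    rw [Real.norm_eq_abs]; linarith
  have hn1 : (1 + ‖t‖) / 2 ≤ ‖s + 1‖ := by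
    have a := Complex.abs_re_le_norm (s + 1)
    have b := Complex.abs_im_le_norm (s + 1)
    rw [Complex.add_re, hre, Complex.one_re, abs_of_pos (by linarith)] at a
    rw [Complex.add_im, him, Complex.one_im, add_zero] at b
    rw [Real.norm_eq_abs]; linarith
  have hp : 0 < 1 + ‖t‖ := by positivity
  rw [hK, norm_div, norm_one, norm_mul, Real.rpow_neg hp.le]
  have e : ((1 + ‖t‖) ^ (2 : ℝ)) = (1 + ‖t‖) ^ 2 := by exact_mod_cast Real.rpow_natCast _ 2
  rw [e]
  calc 1 / (‖s‖ * ‖s + 1‖) ≤ 1 / ((1 + ‖t‖) / 2 * ((1 + ‖t‖) / 2)) := by gcongr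
    _ = _ := by field_simp; norm_num

lemma K_cont (σ : ℝ) (hσ : 1 ≤ σ) : Continuous (fun t : ℝ => K (σ + t * Complex.I)) := by
  unfold K
  refine Continuous.sub (Continuous.div (by fun_prop) (by fun_prop) ?_)
    (Continuous.div (by fun_prop) (by fun_prop) ?_)
  · intro t h
    have := congrArg Complex.re h
    simp at this; linarith
  · intro t h
    have := congrArg Complex.re h
    simp at this; linarith

lemma K_int (σ : ℝ) (hσ : 1 ≤ σ) : MeasureTheory.Integrable (fun t : ℝ => K (σ + t * Complex.I)) := by
  refine MeasureTheory.Integrable.mono' (g := fun t : ℝ => 4 * (1 + ‖t‖) ^ (-2 : ℝ)) ?_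
    (K_cont σ hσ).aestronglyMeasurable (Filter.Eventually.of_forall (fun t => K_bound σ t hσ))
  exact (integrable_one_add_norm (by simp)).const_mul _

lemma K_inv (σ x : ℝ) (hσ : 1 ≤ σ) (hx : 0 < x) :
    (∫ t : ℝ, (x : ℂ) ^ (-(σ + t * Complex.I)) * K (σ + t * Complex.I)) =
      2 * π * ((max 0 (1 - x) : ℝ) : ℂ) := by
  set f : ℝ → ℂ := fun x => Set.indicator (Set.Ioc 0 1) (fun _ => 1 : ℝ → ℂ) x -
    Set.indicator (Set.Ioc 0 1) (fun t => (t : ℂ) ^ (1 : ℂ) : ℝ → ℂ) x with hf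
  have hmel : ∀ s : ℂ, 0 < s.re → HasMellin f s (K s) := by
    intro s hs
    have h1 := hasMellin_one_Ioc hs
    have h2 := hasMellin_cpow_Ioc 1 (s := s) (by simp; linarith)
    have := hasMellin_sub h1.1 h2.1
    rw [h1.2, h2.2] at this
    exact this
  have hfeq : ∀ y : ℝ, 0 < y → f y = ((max 0 (1 - y) : ℝ) : ℂ) := by
    intro y hy
    simp only [hf]
    by_cases h : y ≤ 1
    · have hmem : y ∈ Set.Ioc (0:ℝ) 1 := ⟨hy, h⟩
      rw [Set.indicator_of_mem hmem, Set.indicator_of_mem hmem, max_eq_right (by linarith)]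
      simp
    · have : y ∉ Set.Ioc (0:ℝ) 1 := fun h' => h h'.2
      rw [Set.indicator_of_notMem this, Set.indicator_of_notMem this, max_eq_left (by linarith)]
      simp
  have hm : (fun t : ℝ => mellin f (σ + t * Complex.I)) = fun t : ℝ => K (σ + t * Complex.I) := by
    ext t
    exact (hmel _ (by simp; linarith)).2
  have h := mellinInv_mellin_eq σ f hx (hmel σ (by simp; linarith)).1 ?_ ?_
  · rw [mellinInv, hfeq x hx] at h
    have e : (∫ t : ℝ, (x : ℂ) ^ (-(σ + t * Complex.I)) • mellin f (σ + t * Complex.I)) =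
        ∫ t : ℝ, (x : ℂ) ^ (-(σ + t * Complex.I)) * K (σ + t * Complex.I) := by
      congr 1; ext t
      rw [smul_eq_mul, congrFun hm t]
    rw [e] at h
    generalize (∫ t : ℝ, (x : ℂ) ^ (-(σ + t * Complex.I)) * K (σ + t * Complex.I)) = J at h ⊢
    rw [← h, Complex.real_smul]
    have : (π : ℂ) ≠ 0 := by exact_mod_cast Real.pi_ne_zero
    push_cast
    field_simp
  · unfold Complex.VerticalIntegrable
    rw [hm]; exact K_int σ hσ
  · have : f =ᶠ[nhds x] fun y => ((max 0 (1 - y) : ℝ) : ℂ) := by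
      filter_upwards [isOpen_Ioi.mem_nhds hx] with y hy using hfeq y hy
    refine ContinuousAt.congr ?_ this.symm
    fun_prop

lemma perron (k : ℕ) (hk0 : k ≠ 0) (X σ : ℝ) (hX : 0 < X) (hσ : 1 < σ) :
    HasSum (fun n : ℕ => (2 * π * (co k n * ((max 0 (1 - n / X) : ℝ) : ℂ)) : ℂ))
      (∫ t : ℝ, LSeries (fun n => (co k n : ℂ)) (σ + t * Complex.I) *
        (((X⁻¹ : ℝ) : ℂ) ^ (-(σ + t * Complex.I)) * K (σ + t * Complex.I))) := by
  set s : ℝ → ℂ := fun t => σ + t * Complex.I with hs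
  have hre : ∀ t, (s t).re = σ := by intro t; simp [hs]
  set f : ℕ → ℂ := fun n => (co k n : ℂ) with hf
  set F : ℕ → ℝ → ℂ := fun n t => LSeries.term f (s t) n *
    (((X⁻¹ : ℝ) : ℂ) ^ (-(s t)) * K (s t)) with hF
  have hXi : 0 < X⁻¹ := by positivity
  have hYn : ∀ t, ‖((X⁻¹ : ℝ) : ℂ) ^ (-(s t))‖ = X⁻¹ ^ (-σ) := by
    intro t
    rw [Complex.norm_cpow_eq_rpow_re_of_pos hXi, Complex.neg_re, hre]
  have hterm : ∀ n t, ‖LSeries.term f (s t) n‖ = ‖LSeries.term f (σ : ℂ) n‖ := by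
    intro n t
    rw [LSeries.norm_term_eq, LSeries.norm_term_eq, hre]; simp
  have hFn : ∀ n t, ‖F n t‖ = ‖LSeries.term f (σ : ℂ) n‖ * (X⁻¹ ^ (-σ) * ‖K (s t)‖) := by
    intro n t
    rw [hF]; simp only [norm_mul]; rw [hYn, hterm]
  have hKi := K_int σ hσ.le
  have hsc : Continuous s := by rw [hs]; fun_prop
  have hFi : ∀ n, MeasureTheory.Integrable (F n) := by
    intro n
    refine MeasureTheory.Integrable.mono'
      (g := fun t => ‖LSeries.term f (σ : ℂ) n‖ * (X⁻¹ ^ (-σ) * ‖K (s t)‖))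
      ((hKi.norm.const_mul _).const_mul _) ?_ (Filter.Eventually.of_forall fun t => (hFn n t).le)
    apply Continuous.aestronglyMeasurable
    refine Continuous.mul ?_ (Continuous.mul ?_ (K_cont σ hσ.le))
    · rcases eq_or_ne n 0 with rfl | hn
      · simp only [LSeries.term_zero]; exact continuous_const
      · simp only [LSeries.term_of_ne_zero hn]
        have hn' : (n : ℂ) ≠ 0 := by exact_mod_cast hn
        refine Continuous.div continuous_const (hsc.const_cpow (Or.inl hn')) ?_
        intro t
        rw [Complex.cpow_ne_zero_iff]
        exact Or.inl hn'
    · exact (hsc.neg).const_cpow (Or.inl (by exact_mod_cast hXi.ne'))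
  have hsumm : Summable (fun n => ∫ t, ‖F n t‖) := by
    simp_rw [hFn, MeasureTheory.integral_const_mul]
    exact ((G_LSeries k σ (by simpa using hσ)).1.norm).mul_right _
  have hmain := MeasureTheory.hasSum_integral_of_summable_integral_norm hFi hsumm
  have e1 : (fun n => ∫ t, F n t) = fun n : ℕ => (2 * π * (co k n * ((max 0 (1 - n / X) : ℝ) : ℂ)) : ℂ) := by
    ext n
    rcases eq_or_ne n 0 with rfl | hn
    · simp [hF, co, hk0]
    have hnp : (0:ℝ) < n := by exact_mod_cast Nat.pos_of_ne_zero hn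
    have hk := K_inv σ (n * X⁻¹) hσ.le (by positivity)
    have : F n = fun t => f n * (((n * X⁻¹ : ℝ) : ℂ) ^ (-(s t)) * K (s t)) := by
      ext t
      rw [hF]
      simp only [LSeries.term_of_ne_zero hn]
      rw [Complex.ofReal_mul, Complex.mul_cpow_ofReal_nonneg hnp.le hXi.le, Complex.ofReal_natCast,
        Complex.cpow_neg (n : ℂ) (s t), div_eq_mul_inv]
      ring
    rw [this, MeasureTheory.integral_const_mul, hs, hk, hf, div_eq_mul_inv]
    ring
  rw [e1] at hmain
  have e2 : (fun t => ∑' n, F n t) = fun t : ℝ => LSeries f (σ + t * Complex.I) *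
        (((X⁻¹ : ℝ) : ℂ) ^ (-(σ + t * Complex.I)) * K (σ + t * Complex.I)) := by
    funext t
    simp only [hF]
    rw [tsum_mul_right]
    rfl
  rw [e2] at hmain
  exact hmain

/-- Cesaro sums -/
noncomputable def B (k : ℕ) (X : ℝ) : ℝ := ∑ n ∈ Finset.range (⌊X⌋₊ + 1), co k n * max 0 (X - n)

lemma B_bound (k : ℕ) (hk0 : k ≠ 0) (hk : k ≤ 4) :
    ∃ C, 0 ≤ C ∧ ∀ X : ℝ, 3 ≤ X → |B k X| ≤ C * X ^ 2 := by
  obtain ⟨C, hC, hG⟩ := G_bound k hk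
  set J : ℝ := ∫ t : ℝ, (1 + ‖t‖) ^ (-(3/2) : ℝ) with hJ
  have hJ0 : 0 ≤ J := MeasureTheory.integral_nonneg (fun t => by positivity)
  have hJi : MeasureTheory.Integrable (fun t : ℝ => (1 + ‖t‖) ^ (-(3/2) : ℝ)) :=
    integrable_one_add_norm (by simp; norm_num)
  refine ⟨12 * C * Real.exp 1 * J, by positivity, ?_⟩
  intro X hX
  have hXp : 0 < X := by linarith
  have hL : 1 ≤ Real.log X := by
    rw [Real.le_log_iff_exp_le hXp]
    linarith [Real.exp_one_lt_d9]
  set σ : ℝ := 1 + 1 / Real.log X with hσ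
  have hσ1 : 1 < σ := by rw [hσ]; have : 0 < 1 / Real.log X := by positivity
                         linarith
  have hσ2 : σ ≤ 2 := by
    rw [hσ]
    have : 1 / Real.log X ≤ 1 := by rw [div_le_one (by linarith)]; exact hL
    linarith
  have hp := perron k hk0 X σ hXp hσ1
  have hXs : X⁻¹ ^ (-σ) = Real.exp 1 * X := by
    rw [Real.inv_rpow hXp.le, Real.rpow_neg hXp.le, inv_inv, hσ, Real.rpow_add hXp, Real.rpow_one,
      Real.rpow_def_of_pos hXp, mul_one_div_cancel (by linarith), mul_comm]
  have hI : ‖∫ t : ℝ, LSeries (fun n => (co k n : ℂ)) (σ + t * Complex.I) *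
        (((X⁻¹ : ℝ) : ℂ) ^ (-(σ + t * Complex.I)) * K (σ + t * Complex.I))‖ ≤
        ∫ t : ℝ, (12 * C * (Real.exp 1 * X)) * (1 + ‖t‖) ^ (-(3/2) : ℝ) := by
    refine MeasureTheory.norm_integral_le_of_norm_le (hJi.const_mul _)
      (Filter.Eventually.of_forall fun t => ?_)
    have hre : ((σ : ℂ) + t * Complex.I).re = σ := by simp
    have him : ((σ : ℂ) + t * Complex.I).im = t := by simp
    have hp : 0 < 1 + ‖t‖ := by positivity
    have h1 : ‖LSeries (fun n => (co k n : ℂ)) (σ + t * Complex.I)‖ ≤ C * (3 * (1 + ‖t‖) ^ (1/2 : ℝ)) := by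
      rw [(G_LSeries k _ (by rw [hre]; exact hσ1)).2, norm_mul, norm_pow, norm_neg, norm_one, one_pow,
        one_mul]
      refine (hG _ (by rw [hre]; exact hσ1) (by rw [hre]; exact hσ2)).trans ?_
      rw [him]
      refine mul_le_mul_of_nonneg_left ?_ hC
      calc (|t| + 3) ^ (1/2 : ℝ) ≤ (3 * (1 + ‖t‖)) ^ (1/2 : ℝ) := by
            apply Real.rpow_le_rpow (by positivity) _ (by norm_num)
            rw [Real.norm_eq_abs]; linarith [abs_nonneg t]
        _ = 3 ^ (1/2 : ℝ) * (1 + ‖t‖) ^ (1/2 : ℝ) := Real.mul_rpow (by norm_num) hp.le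
        _ ≤ 3 * (1 + ‖t‖) ^ (1/2 : ℝ) := by
            gcongr
            calc (3:ℝ) ^ (1/2 : ℝ) ≤ 3 ^ (1 : ℝ) :=
                  Real.rpow_le_rpow_of_exponent_le (by norm_num) (by norm_num)
              _ = 3 := Real.rpow_one _
    have h2 : ‖((X⁻¹ : ℝ) : ℂ) ^ (-(σ + t * Complex.I))‖ = Real.exp 1 * X := by
      rw [Complex.norm_cpow_eq_rpow_re_of_pos (by positivity), Complex.neg_re, hre, hXs]
    have h3 := K_bound σ t hσ1.le
    rw [norm_mul, norm_mul, h2]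
    calc _ ≤ C * (3 * (1 + ‖t‖) ^ (1/2 : ℝ)) * (Real.exp 1 * X * (4 * (1 + ‖t‖) ^ (-2 : ℝ))) := by
          gcongr
      _ = 12 * C * (Real.exp 1 * X) * ((1 + ‖t‖) ^ (1/2 : ℝ) * (1 + ‖t‖) ^ (-2 : ℝ)) := by ring
      _ = _ := by rw [← Real.rpow_add hp]; norm_num
  rw [MeasureTheory.integral_const_mul, ← hJ] at hI
  have hfin : HasSum (fun n : ℕ => (2 * π * (co k n * ((max 0 (1 - n / X) : ℝ) : ℂ)) : ℂ))
      (∑ n ∈ Finset.range (⌊X⌋₊ + 1), (2 * π * (co k n * ((max 0 (1 - n / X) : ℝ) : ℂ)) : ℂ)) := by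
    apply hasSum_sum_of_ne_finset_zero
    intro n hn
    have hn' : ⌊X⌋₊ < n := by simpa using hn
    have : X < n := (Nat.floor_lt hXp.le).1 hn'
    have : 1 - (n : ℝ) / X ≤ 0 := by
      have : 1 ≤ (n : ℝ) / X := by rw [le_div_iff₀ hXp]; linarith
      linarith
    rw [max_eq_left this]; simp
  have heq := hp.unique hfin
  have hB : (∑ n ∈ Finset.range (⌊X⌋₊ + 1), (2 * π * (co k n * ((max 0 (1 - n / X) : ℝ) : ℂ)) : ℂ)) =
      ((2 * π * (B k X / X) : ℝ) : ℂ) := by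
    rw [B, Finset.sum_div, Finset.mul_sum]
    push_cast
    apply Finset.sum_congr rfl
    intro n _
    have : max 0 (1 - (n : ℝ) / X) = max 0 (X - n) / X := by
      rw [← max_div_div_right hXp.le, zero_div, sub_div, div_self hXp.ne']
    have h2 : ((max 0 (1 - (n : ℝ) / X) : ℝ) : ℂ) = ((max 0 (X - n) : ℝ) : ℂ) / X := by
      rw [this]; push_cast; rfl
    rw [h2]; ring
  rw [heq, hB, Complex.norm_real, Real.norm_eq_abs, abs_mul, abs_div, abs_of_pos hXp,
    abs_of_pos (by positivity : 0 < 2 * π)] at hI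
  have hpi : 1 ≤ 2 * π := by linarith [Real.pi_gt_three]
  have : |B k X| / X ≤ 12 * C * (Real.exp 1 * X) * J := by
    refine le_trans ?_ hI
    exact le_mul_of_one_le_left (by positivity) hpi
  rw [div_le_iff₀ hXp] at this
  calc |B k X| ≤ _ := this
    _ = _ := by ring

end PNTaux


namespace PNTaux

lemma sum_inv_sqrt (N : ℕ) : ∑ n ∈ Finset.Icc 1 N, 1 / √(n : ℝ) ≤ 2 * √(N : ℝ) := by
  induction N with
  | zero => simp
  | succ m ih =>
    rw [Finset.sum_Icc_succ_top (by omega)]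
    have a : 0 ≤ √(m : ℝ) := Real.sqrt_nonneg _
    have b : 0 < √((m + 1 : ℕ) : ℝ) := by positivity
    have ea : √(m : ℝ) ^ 2 = m := Real.sq_sqrt (by positivity)
    have eb : √((m + 1 : ℕ) : ℝ) ^ 2 = m + 1 := by rw [Real.sq_sqrt (by positivity)]; push_cast; ring
    have : 1 / √((m + 1 : ℕ) : ℝ) ≤ 2 * √((m + 1 : ℕ) : ℝ) - 2 * √(m : ℝ) := by
      rw [div_le_iff₀ b]
      nlinarith [sq_nonneg (√((m + 1 : ℕ) : ℝ) - √(m : ℝ))]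
    linarith

/-- weight -/
noncomputable def w (X : ℝ) (n : ℕ) : ℝ := Real.log n ^ 3 * (5 * Real.log X - 4 * Real.log n)

lemma sum_w (X : ℝ) (hX : 3 ≤ X) :
    Real.log X ^ 4 * (X - 1) + Real.log X ^ 3 * (Real.log 2 * (X / 2 - 1)) - 288 * Real.log X ^ 2 * X ≤
      ∑ n ∈ Finset.range (⌊X⌋₊ + 1), w X n := by
  have hXp : 0 < X := by linarith
  have hL : 0 < Real.log X := Real.log_pos (by linarith)
  set L := Real.log X with hLdef
  set v : ℕ → ℝ := fun n => L - Real.log n with hv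
  have hN : ∀ n ∈ Finset.Icc 1 ⌊X⌋₊, (1:ℝ) ≤ n ∧ (n : ℝ) ≤ X := by
    intro n hn
    rw [Finset.mem_Icc] at hn
    exact ⟨by exact_mod_cast hn.1, (Nat.le_floor_iff hXp.le).1 hn.2⟩
  have hv0 : ∀ n ∈ Finset.Icc 1 ⌊X⌋₊, 0 ≤ v n ∧ v n ≤ L := by
    intro n hn
    obtain ⟨h1, h2⟩ := hN n hn
    have := Real.log_le_log (by linarith) h2
    have := Real.log_nonneg h1
    simp only [hv]; constructor <;> linarith
  have hsum : ∑ n ∈ Finset.range (⌊X⌋₊ + 1), w X n = ∑ n ∈ Finset.Icc 1 ⌊X⌋₊, w X n := by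
    symm
    apply Finset.sum_subset
    · intro n hn; simp at hn ⊢; omega
    · intro n hn hn'
      have : n = 0 := by simp at hn hn'; omega
      simp [this, w]
  have hw : ∀ n ∈ Finset.Icc 1 ⌊X⌋₊, L ^ 4 + L ^ 3 * v n - 9 * L ^ 2 * v n ^ 2 ≤ w X n := by
    intro n hn
    obtain ⟨h1, h2⟩ := hv0 n hn
    have e : w X n = (L - v n) ^ 3 * (L + 4 * v n) := by simp only [w, hv]; ring
    rw [e]
    have : 0 ≤ v n ^ 3 * (11 * L - 4 * v n) := mul_nonneg (by positivity) (by linarith)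
    nlinarith [this]
  have s0 : X - 1 ≤ ∑ n ∈ Finset.Icc 1 ⌊X⌋₊, (1:ℝ) := by
    simp
    linarith [Nat.lt_floor_add_one X]
  have s1 : Real.log 2 * (X / 2 - 1) ≤ ∑ n ∈ Finset.Icc 1 ⌊X⌋₊, v n := by
    have hl2 : 0 < Real.log 2 := Real.log_pos (by norm_num)
    calc Real.log 2 * (X / 2 - 1) ≤ Real.log 2 * ⌊X / 2⌋₊ := by
          gcongr; linarith [Nat.lt_floor_add_one (X / 2)]
      _ = ∑ n ∈ Finset.Icc 1 ⌊X / 2⌋₊, Real.log 2 := by simp [mul_comm]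
      _ ≤ ∑ n ∈ Finset.Icc 1 ⌊X / 2⌋₊, v n := by
          apply Finset.sum_le_sum
          intro n hn
          rw [Finset.mem_Icc] at hn
          have h2 := (Nat.le_floor_iff (by linarith)).1 hn.2
          have h1 : (1:ℝ) ≤ n := by exact_mod_cast hn.1
          have := Real.log_le_log (by linarith) h2
          rw [Real.log_div (by linarith) (by norm_num)] at this
          simp only [hv]; linarith
      _ ≤ _ := by
          apply Finset.sum_le_sum_of_subset_of_nonneg
          · apply Finset.Icc_subset_Icc_right
            exact Nat.floor_le_floor (by linarith)
          · intro n hn _; exact (hv0 n hn).1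
  have s2 : ∑ n ∈ Finset.Icc 1 ⌊X⌋₊, v n ^ 2 ≤ 32 * X := by
    calc ∑ n ∈ Finset.Icc 1 ⌊X⌋₊, v n ^ 2 ≤ ∑ n ∈ Finset.Icc 1 ⌊X⌋₊, 16 * √X * (1 / √(n : ℝ)) := by
          apply Finset.sum_le_sum
          intro n hn
          obtain ⟨h1, h2⟩ := hN n hn
          have hnp : (0:ℝ) < n := by linarith
          have e : v n = Real.log (X / n) := by rw [Real.log_div hXp.ne' hnp.ne']
          have hq : 0 < X / n := by positivity
          have hb := Real.log_le_rpow_div hq.le (ε := 1/4) (by norm_num)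
          rw [← e] at hb
          have h0 := (hv0 n hn).1
          calc v n ^ 2 ≤ ((X / n) ^ (1/4 : ℝ) / (1/4)) ^ 2 := by gcongr
            _ = 16 * ((X / n) ^ (1/4 : ℝ)) ^ 2 := by ring
            _ = 16 * (X / n) ^ (1/2 : ℝ) := by
                rw [← Real.rpow_natCast, ← Real.rpow_mul hq.le]; norm_num
            _ = _ := by rw [← Real.sqrt_eq_rpow, Real.sqrt_div hXp.le]; ring
      _ = 16 * √X * ∑ n ∈ Finset.Icc 1 ⌊X⌋₊, 1 / √(n : ℝ) := by rw [Finset.mul_sum]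
      _ ≤ 16 * √X * (2 * √X) := by
          have := sum_inv_sqrt ⌊X⌋₊
          have h3 : √((⌊X⌋₊ : ℕ) : ℝ) ≤ √X := Real.sqrt_le_sqrt (Nat.floor_le hXp.le)
          gcongr
          linarith
      _ = 32 * (√X) ^ 2 := by ring
      _ = 32 * X := by rw [Real.sq_sqrt hXp.le]
  rw [hsum]
  clear_value v
  calc _ ≤ L ^ 4 * ∑ n ∈ Finset.Icc 1 ⌊X⌋₊, (1:ℝ) + L ^ 3 * ∑ n ∈ Finset.Icc 1 ⌊X⌋₊, v n
        - 9 * L ^ 2 * ∑ n ∈ Finset.Icc 1 ⌊X⌋₊, v n ^ 2 := by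
        have a := mul_le_mul_of_nonneg_left s0 (by positivity : 0 ≤ L ^ 4)
        have b := mul_le_mul_of_nonneg_left s1 (by positivity : 0 ≤ L ^ 3)
        have c := mul_le_mul_of_nonneg_left s2 (by positivity : 0 ≤ 9 * L ^ 2)
        linarith
    _ = ∑ n ∈ Finset.Icc 1 ⌊X⌋₊, (L ^ 4 + L ^ 3 * v n - 9 * L ^ 2 * v n ^ 2) := by
        rw [Finset.sum_sub_distrib, Finset.sum_add_distrib, Finset.mul_sum, Finset.mul_sum, Finset.mul_sum]
        simp
    _ ≤ _ := Finset.sum_le_sum hw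

lemma w_bound (X : ℝ) (hX : 3 ≤ X) (n : ℕ) (hn : n ∈ Finset.range (⌊X⌋₊ + 1)) :
    0 ≤ w X n ∧ w X n ≤ 5 * Real.log X ^ 4 := by
  have hXp : 0 < X := by linarith
  have hL : 0 < Real.log X := Real.log_pos (by linarith)
  rcases Nat.eq_zero_or_pos n with rfl | hnp
  · simp [w]; positivity
  have h1 : (1:ℝ) ≤ n := by exact_mod_cast hnp
  have h2 : (n:ℝ) ≤ X := (Nat.le_floor_iff hXp.le).1 (by simp at hn; omega)
  have a := Real.log_nonneg h1
  have b := Real.log_le_log (by linarith) h2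
  unfold w
  constructor
  · exact mul_nonneg (by positivity) (by linarith)
  · calc _ ≤ Real.log X ^ 3 * (5 * Real.log X) := by gcongr <;> linarith
      _ = _ := by ring

lemma B_ext (k : ℕ) (X' X : ℝ) (h0 : 0 ≤ X') (h : X' ≤ X) :
    B k X' = ∑ n ∈ Finset.range (⌊X⌋₊ + 1), co k n * max 0 (X' - n) := by
  unfold B
  apply Finset.sum_subset
  · intro n hn
    have := Nat.floor_le_floor h
    simp at hn ⊢; omega
  · intro n _ hn
    have hn' : ⌊X'⌋₊ < n := by simp at hn; omega
    have : X' < n := (Nat.floor_lt h0).1 hn'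
    rw [max_eq_left (by linarith), mul_zero]

lemma Phi_lower : ∃ C, 0 ≤ C ∧ ∀ X h : ℝ, 3 ≤ X → 0 < h → 3 ≤ X - h →
    h * ∑ n ∈ Finset.range (⌊X⌋₊ + 1), w X n - 5 * Real.log X ^ 4 * h * (h + 1) - C * Real.log X * X ^ 2 ≤
      h * ∑ n ∈ Finset.range (⌊X⌋₊ + 1), ArithmeticFunction.vonMangoldt n * w X n := by
  obtain ⟨C3, h30, h3⟩ := B_bound 3 (by norm_num) (by norm_num)
  obtain ⟨C4, h40, h4⟩ := B_bound 4 (by norm_num) (by norm_num)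
  refine ⟨10 * C3 + 8 * C4, by positivity, ?_⟩
  intro X h hX hh hXh
  have hXp : 0 < X := by linarith
  have hL : 1 ≤ Real.log X := by
    rw [Real.le_log_iff_exp_le hXp]
    linarith [Real.exp_one_lt_d9]
  set L := Real.log X with hLdef
  set S := Finset.range (⌊X⌋₊ + 1) with hS
  set d : ℕ → ℝ := fun n => max 0 (X - n) - max 0 (X - h - n) with hd
  have hd0 : ∀ n, 0 ≤ d n := by
    intro n
    have : max 0 (X - h - n) ≤ max 0 (X - n) := max_le_max le_rfl (by linarith)
    simp only [hd]; linarith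
  have hd1 : ∀ n, d n ≤ h := by
    intro n
    have : max 0 (X - n) ≤ max 0 (X - h - n) + h := by
      apply max_le
      · have := le_max_left 0 (X - h - n); linarith
      · have := le_max_right 0 (X - h - n); linarith
    simp only [hd]; linarith
  have hd2 : ∀ n : ℕ, (n : ℝ) ≤ X - h → d n = h := by
    intro n hn
    simp only [hd]
    rw [max_eq_right (by linarith), max_eq_right (by linarith)]; ring
  have hid : ∑ n ∈ S, (ArithmeticFunction.vonMangoldt n - 1) * w X n * d n =
      5 * L * (B 3 X - B 3 (X - h)) - 4 * (B 4 X - B 4 (X - h)) := by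
    rw [B_ext 3 (X - h) X (by linarith) (by linarith), B_ext 4 (X - h) X (by linarith) (by linarith), B, B,
      ← Finset.sum_sub_distrib, ← Finset.sum_sub_distrib, Finset.mul_sum, Finset.mul_sum,
      ← Finset.sum_sub_distrib]
    apply Finset.sum_congr rfl
    intro n _
    simp only [co, w, hd]; ring
  have hlow : -((10 * C3 + 8 * C4) * L * X ^ 2) ≤
      ∑ n ∈ S, (ArithmeticFunction.vonMangoldt n - 1) * w X n * d n := by
    rw [hid]
    have hsq : (X - h) ^ 2 ≤ X ^ 2 := by gcongr <;> linarith
    have a1 := abs_le.1 (h3 X hX)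
    have a2 := abs_le.1 (h3 (X - h) hXh)
    have a3 := abs_le.1 (h4 X hX)
    have a4 := abs_le.1 (h4 (X - h) hXh)
    have q3 := mul_le_mul_of_nonneg_left hsq h30
    have q4 := mul_le_mul_of_nonneg_left hsq h40
    have r3 : -(2 * C3 * X ^ 2) ≤ B 3 X - B 3 (X - h) := by linarith [a1.1, a2.2]
    have r4 : B 4 X - B 4 (X - h) ≤ 2 * C4 * X ^ 2 := by linarith [a3.2, a4.1]
    have u := mul_le_mul_of_nonneg_left r3 (by positivity : 0 ≤ 5 * L)
    have t : C4 * X ^ 2 ≤ C4 * X ^ 2 * L := le_mul_of_one_le_right (by positivity) hL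
    linarith
  have hup : ∑ n ∈ S, ArithmeticFunction.vonMangoldt n * w X n * d n ≤
      h * ∑ n ∈ S, ArithmeticFunction.vonMangoldt n * w X n := by
    rw [Finset.mul_sum]
    apply Finset.sum_le_sum
    intro n hn
    rw [mul_comm]
    exact mul_le_mul_of_nonneg_right (hd1 n)
      (mul_nonneg ArithmeticFunction.vonMangoldt_nonneg (w_bound X hX n hn).1)
  have hw : h * ∑ n ∈ S, w X n - ∑ n ∈ S, w X n * d n ≤ 5 * L ^ 4 * h * (h + 1) := by
    rw [Finset.mul_sum, ← Finset.sum_sub_distrib]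
    calc ∑ n ∈ S, (h * w X n - w X n * d n) ≤
        ∑ n ∈ S, if X - h < (n:ℝ) then 5 * L ^ 4 * h else 0 := by
          apply Finset.sum_le_sum
          intro n hn
          obtain ⟨b0, b1⟩ := w_bound X hX n hn
          split_ifs with hc
          · have := mul_nonneg b0 (hd0 n)
            have := mul_le_mul_of_nonneg_left b1 hh.le
            linarith
          · rw [hd2 n (by linarith)]; linarith
      _ = (S.filter (fun n : ℕ => X - h < (n:ℝ))).card * (5 * L ^ 4 * h) := by
          rw [← Finset.sum_filter]; simp
      _ ≤ (h + 1) * (5 * L ^ 4 * h) := by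
          gcongr
          have hsub : S.filter (fun n : ℕ => X - h < (n:ℝ)) ⊆ Finset.Ioc ⌊X - h⌋₊ ⌊X⌋₊ := by
            intro n hn
            rw [Finset.mem_filter, hS, Finset.mem_range] at hn
            rw [Finset.mem_Ioc, Nat.floor_lt (by linarith)]
            exact ⟨hn.2, by omega⟩
          have hc := Finset.card_le_card hsub
          rw [Nat.card_Ioc] at hc
          have hfl : ⌊X - h⌋₊ ≤ ⌊X⌋₊ := Nat.floor_le_floor (by linarith)
          have hc' : ((S.filter (fun n : ℕ => X - h < (n:ℝ))).card : ℝ) ≤ (⌊X⌋₊ : ℝ) - ⌊X - h⌋₊ := by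
            rw [← Nat.cast_sub hfl]; exact_mod_cast hc
          linarith [Nat.floor_le hXp.le, Nat.lt_floor_add_one (X - h)]
      _ = _ := by ring
  have hsplit : ∑ n ∈ S, (ArithmeticFunction.vonMangoldt n - 1) * w X n * d n =
      ∑ n ∈ S, ArithmeticFunction.vonMangoldt n * w X n * d n - ∑ n ∈ S, w X n * d n := by
    rw [← Finset.sum_sub_distrib]
    apply Finset.sum_congr rfl
    intro n _; ring
  linarith

end PNTaux


namespace PNTaux

lemma Phi_upper (X : ℝ) (hX : 3 ≤ X) :
    ∑ n ∈ Finset.range (⌊X⌋₊ + 1), ArithmeticFunction.vonMangoldt n * w X n ≤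
      Real.log X ^ 5 * primePi X + 10 * Real.log X ^ 5 * √X := by
  have hXp : 0 < X := by linarith
  have hL : 0 < Real.log X := Real.log_pos (by linarith)
  have hr : Finset.range (⌊X⌋₊ + 1) = Finset.Iic ⌊X⌋₊ := by
    ext n; simp
  rw [← Finset.sum_filter_add_sum_filter_not _ Nat.Prime]
  apply add_le_add
  · unfold primePi
    rw [← hr]
    calc _ ≤ ∑ n ∈ (Finset.range (⌊X⌋₊ + 1)).filter Nat.Prime, Real.log X ^ 5 := by
          apply Finset.sum_le_sum
          intro p hp
          rw [Finset.mem_filter] at hp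
          have h1 : (1:ℝ) ≤ p := by exact_mod_cast hp.2.one_lt.le
          have h2 : (p:ℝ) ≤ X := (Nat.le_floor_iff hXp.le).1 (by have := hp.1; simp at this; omega)
          have a := Real.log_nonneg h1
          have b := Real.log_le_log (by linarith) h2
          rw [ArithmeticFunction.vonMangoldt_apply_prime hp.2, w]
          have : 0 ≤ (Real.log X - Real.log p) ^ 2 * (Real.log X ^ 3 + 2 * Real.log X ^ 2 * Real.log p
            + 3 * Real.log X * Real.log p ^ 2 + 4 * Real.log p ^ 3) := by positivity
          linarith
      _ = _ := by rw [Finset.sum_const, nsmul_eq_mul, mul_comm]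
  · have h1 := Chebyshev.psi_sub_theta_le (x := X) (by linarith)
    rw [Chebyshev.psi_sub_theta_eq_sum_not_prime] at h1
    calc _ ≤ ∑ n ∈ (Finset.range (⌊X⌋₊ + 1)).filter (fun n => ¬ n.Prime),
            5 * Real.log X ^ 4 * ArithmeticFunction.vonMangoldt n := by
          apply Finset.sum_le_sum
          intro n hn
          rw [Finset.mem_filter] at hn
          rw [mul_comm]
          exact mul_le_mul_of_nonneg_right (w_bound X hX n hn.1).2 ArithmeticFunction.vonMangoldt_nonneg
      _ = 5 * Real.log X ^ 4 * ∑ n ∈ (Finset.Ioc 0 ⌊X⌋₊).filter (fun n => ¬ n.Prime),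
            ArithmeticFunction.vonMangoldt n := by
          rw [← Finset.mul_sum]
          congr 1
          symm
          apply Finset.sum_subset
          · intro n hn; simp at hn ⊢; exact ⟨by omega, hn.2⟩
          · intro n hn hn'
            have : n = 0 := by
              by_contra h0
              apply hn'
              simp at hn ⊢; exact ⟨by omega, hn.2⟩
            simp [this]
      _ ≤ 5 * Real.log X ^ 4 * (2 * √X * Real.log X) := by gcongr
      _ = _ := by ring

lemma final : ∃ x₀ : ℝ, 3 ≤ x₀ ∧ ∀ X : ℝ, x₀ ≤ X →
    primePi X - X / Real.log X ≥ (1/10) * X / (Real.log X) ^ 2 := by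
  obtain ⟨C, hC, hlow⟩ := Phi_lower
  have hLt := Real.tendsto_log_atTop
  have e1 : ∀ᶠ X : ℝ in atTop, Real.log X ≤ X / 200 := by
    have := (Real.isLittleO_log_id_atTop).bound (c := 1/200) (by norm_num)
    filter_upwards [this, eventually_ge_atTop 1] with X h h1
    have a := Real.log_nonneg h1
    rw [Real.norm_eq_abs, abs_of_nonneg a, id, Real.norm_eq_abs, abs_of_nonneg (by linarith)] at h
    linarith
  have e2 : ∀ᶠ X : ℝ in atTop, Real.log X ^ 2 ≤ √X / 250 := by
    have := (isLittleO_log_rpow_rpow_atTop 2 (by norm_num : (0:ℝ) < 1/2)).bound (c := 1/250) (by norm_num)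
    filter_upwards [this, eventually_ge_atTop 1] with X h h1
    have a := Real.log_nonneg h1
    rw [← Real.sqrt_eq_rpow, Real.norm_eq_abs, abs_of_nonneg (by positivity), Real.norm_eq_abs,
      abs_of_nonneg (by positivity)] at h
    have : Real.log X ^ (2:ℝ) = Real.log X ^ 2 := by exact_mod_cast Real.rpow_natCast _ 2
    rw [this] at h
    linarith
  have e3 := hLt.eventually (eventually_ge_atTop (max 7200 ((25 * (5 + C)) ^ 2)))
  obtain ⟨x₀, hx₀⟩ := eventually_atTop.1 (e1.and (e2.and e3))
  refine ⟨max x₀ 25, le_trans (by norm_num) (le_max_right _ _), ?_⟩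
  intro X hX
  have hX25 : 25 ≤ X := (le_max_right _ _).trans hX
  obtain ⟨f1, f2, f3⟩ := hx₀ X ((le_max_left _ _).trans hX)
  have hXp : 0 < X := by linarith
  set L := Real.log X with hLdef
  have f4 : 7200 ≤ L := (le_max_left _ _).trans f3
  have f5 : (25 * (5 + C)) ^ 2 ≤ L := (le_max_right _ _).trans f3
  have hL : 0 < L := by linarith
  set q := √L with hq
  have hqL : q ^ 2 = L := Real.sq_sqrt hL.le
  have hq1 : 1 ≤ q := by rw [hq, Real.one_le_sqrt]; linarith
  have hq0 : 0 < q := by linarith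
  have f6 : 25 * (5 + C) ≤ q := Real.le_sqrt_of_sq_le f5
  set r := √X with hr
  have hrX : r ^ 2 = X := Real.sq_sqrt hXp.le
  have hr0 : 0 < r := Real.sqrt_pos.2 hXp
  set h := X / (L * q) with hh
  have hh0 : 0 < h := by positivity
  have hLq : 2 ≤ L * q := by nlinarith
  have hh2 : h ≤ X / 2 := by rw [hh]; gcongr
  have A := hlow X h (by linarith) hh0 (by linarith)
  have Bd := Phi_upper X (by linarith)
  have W := sum_w X (by linarith)
  rw [← hLdef] at A Bd W
  set Φ := ∑ n ∈ Finset.range (⌊X⌋₊ + 1), ArithmeticFunction.vonMangoldt n * w X n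
  set S := ∑ n ∈ Finset.range (⌊X⌋₊ + 1), w X n
  have hhL : h * (L * q) = X := by rw [hh]; field_simp
  have A' : S - 5 * L ^ 4 * (h + 1) - C * L * X * (L * q) ≤ Φ := by
    have : h * (S - 5 * L ^ 4 * (h + 1) - C * L * X * (L * q)) ≤ h * Φ := by
      refine le_trans (le_of_eq ?_) A
      have : h * (C * L * X * (L * q)) = C * L * X ^ 2 := by
        calc _ = C * L * X * (h * (L * q)) := by ring
          _ = _ := by rw [hhL]; ring
      linarith
    exact le_of_mul_le_mul_left this hh0
  have hl2 : 0.69 < Real.log 2 := by linarith [Real.log_two_gt_d9]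
  have hl2' : Real.log 2 < 0.7 := by linarith [Real.log_two_lt_d9]
  -- the error terms
  have hLh : L ^ 4 * h = L ^ 2 * (q * X) := by
    have : L ^ 4 * h * q = L ^ 2 * (q * X) * q := by
      calc L ^ 4 * h * q = L ^ 3 * (h * (L * q)) := by ring
        _ = L ^ 2 * q ^ 2 * X := by rw [hhL, hqL]; ring
        _ = _ := by ring
    exact mul_right_cancel₀ hq0.ne' this
  have t1 : L ^ 2 * ((5 + C) * (q * X)) ≤ L ^ 3 * X * (1/25) := by
    have : (5 + C) * q ≤ L / 25 := by rw [← hqL]; nlinarith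
    calc L ^ 2 * ((5 + C) * (q * X)) = L ^ 2 * X * ((5 + C) * q) := by ring
      _ ≤ L ^ 2 * X * (L / 25) := by gcongr
      _ = _ := by ring
  have t2 : 288 * L ^ 2 * X ≤ L ^ 3 * X * (1/25) := by
    have := mul_le_mul_of_nonneg_left f4 (by positivity : 0 ≤ L ^ 2 * X)
    linarith
  have t3 : 6 * L ^ 4 ≤ L ^ 3 * X * (1/25) := by
    have := mul_le_mul_of_nonneg_left f1 (by positivity : 0 ≤ L ^ 3)
    have : 0 ≤ L ^ 3 * X := by positivity
    linarith
  have t4 : 10 * L ^ 5 * r ≤ L ^ 3 * X * (1/25) := by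
    have := mul_le_mul_of_nonneg_left f2 (by positivity : 0 ≤ L ^ 3 * r)
    have e : L ^ 3 * r * (r / 250) = L ^ 3 * X / 250 := by rw [← hrX]; ring
    rw [e] at this
    linarith
  have t5 : L ^ 3 * (X * 0.305) ≤ L ^ 3 * (Real.log 2 * (X / 2 - 1)) := by
    apply mul_le_mul_of_nonneg_left _ (by positivity)
    nlinarith
  have main : L ^ 4 * X + L ^ 3 * X * (1/10) ≤ L ^ 5 * primePi X := by
    have : 0 ≤ L ^ 3 * X := by positivity
    have A'' : S - 5 * (L ^ 2 * (q * X)) - 5 * L ^ 4 - C * (L ^ 2 * (q * X)) ≤ Φ := by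
      have e : 5 * L ^ 4 * (h + 1) = 5 * (L ^ 2 * (q * X)) + 5 * L ^ 4 := by rw [← hLh]; ring
      have e' : C * L * X * (L * q) = C * (L ^ 2 * (q * X)) := by ring
      rw [e, e'] at A'
      linarith
    linarith
  have : (1/10) * X / L ^ 2 + X / L = (L ^ 4 * X + L ^ 3 * X * (1/10)) / L ^ 5 := by
    field_simp; ring
  have h5 : (L ^ 4 * X + L ^ 3 * X * (1/10)) / L ^ 5 ≤ primePi X := by
    rw [div_le_iff₀ (by positivity)]; linarith
  linarith

end PNTaux

/-- For all sufficiently large `x`, `π(x) − x/log x ≥ c x/(log x)²`; in particular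
`π(x) − x/log x` is strictly positive for all sufficiently large `x`. -/
theorem primePi_sub_div_log_pos :
    ∃ c x₀ : ℝ, 0 < c ∧ 3 ≤ x₀ ∧
      ∀ x : ℝ, x₀ ≤ x →
        primePi x - x / Real.log x ≥ c * x / (Real.log x) ^ 2 := by
  obtain ⟨x₀, h3, h⟩ := PNTaux.final
  exact ⟨1/10, x₀, by norm_num, h3, h⟩
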